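/- Let r be an integer with 3 ≤ r ≤ 8. Then the face of the nef cone Nef_r cut out by the exceptional class e_r = (0,…,0,1) equals the embedded nef cone of S_{r−1}: {x ∈ Nef_r : B(e_r, x) = 0} = ι(Nef_{r−1}). -/

import Mathlib

open scoped BigOperators
open MeasureTheory

/-- Intersection form on `ℤ^(n+1)` with basis `H, E₁, …, E_n`:
`B(x,y) = x₀y₀ - x₁y₁ - ⋯ - x_n y_n` (written as `2x₀y₀ - ∑ᵢ xᵢyᵢ`). -/
def interZ {n : ℕ} (x y : Fin (n + 1) → ℤ) : ℤ :=
  2 * x 0 * y 0 - ∑ i, x i * y i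

/-- The real intersection form on `ℝ^(n+1)`. -/
def interR {n : ℕ} (x y : Fin (n + 1) → ℝ) : ℝ :=
  2 * x 0 * y 0 - ∑ i, x i * y i

/-- The anticanonical class `-K = (3, -1, …, -1)`. -/
def antiK (n : ℕ) : Fin (n + 1) → ℤ := fun i => if i = 0 then 3 else -1

/-- The anticanonical class as a real vector. -/
def antiKR (n : ℕ) : Fin (n + 1) → ℝ := fun i => if i = 0 then 3 else -1

/-- A `(-1)`-class: `B(E,E) = -1` and `B(-K,E) = 1`. -/
def IsMinusOneClass {n : ℕ} (E : Fin (n + 1) → ℤ) : Prop :=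
  interZ E E = -1 ∧ interZ (antiK n) E = 1

/-- The nef cone: real vectors pairing nonnegatively with every `(-1)`-class. -/
def NefCone (n : ℕ) : Set (Fin (n + 1) → ℝ) :=
  {x | ∀ E : Fin (n + 1) → ℤ, IsMinusOneClass E → 0 ≤ interR (fun i => (E i : ℝ)) x}

section Bilinear

variable {n : ℕ}

lemma interZ_comm (x y : Fin (n + 1) → ℤ) : interZ x y = interZ y x := by
  simp only [interZ, mul_comm (x _) (y _), mul_assoc]

lemma interZ_eq (x y : Fin (n + 1) → ℤ) :
    interZ x y = x 0 * y 0 - ∑ i : Fin n, x i.succ * y i.succ := by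
  rw [interZ, Fin.sum_univ_succ]; ring

lemma interZ_add_right (x y z : Fin (n + 1) → ℤ) :
    interZ x (y + z) = interZ x y + interZ x z := by
  simp only [interZ, Pi.add_apply, mul_add, Finset.sum_add_distrib]; ring

lemma interZ_sub_right (x y z : Fin (n + 1) → ℤ) :
    interZ x (y - z) = interZ x y - interZ x z := by
  simp only [interZ, Pi.sub_apply, mul_sub, Finset.sum_sub_distrib]; ring

lemma interZ_add_left (x y z : Fin (n + 1) → ℤ) :
    interZ (x + y) z = interZ x z + interZ y z := by
  rw [interZ_comm, interZ_add_right, interZ_comm z x, interZ_comm z y]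

lemma interZ_sub_left (x y z : Fin (n + 1) → ℤ) :
    interZ (x - y) z = interZ x z - interZ y z := by
  rw [interZ_comm, interZ_sub_right, interZ_comm z x, interZ_comm z y]

lemma interZ_single_zero (x : Fin (n + 1) → ℤ) : interZ x (Pi.single 0 1) = x 0 := by
  simp [interZ_eq]

lemma interZ_single_succ (x : Fin (n + 1) → ℤ) (i : Fin n) :
    interZ x (Pi.single i.succ 1) = -x i.succ := by
  simp [interZ_eq, Pi.single_apply]

lemma interZ_antiK_left (x : Fin (n + 1) → ℤ) :
    interZ (antiK n) x = 3 * x 0 + ∑ i : Fin n, x i.succ := by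
  simp [interZ_eq, antiK]

lemma interZ_antiK_self : interZ (antiK n) (antiK n) = 9 - n := by
  simp [interZ_antiK_left, antiK]; ring

lemma interR_cast_add (x y : Fin (n + 1) → ℤ) (z : Fin (n + 1) → ℝ) :
    interR (fun i => ((x + y) i : ℝ)) z
      = interR (fun i => (x i : ℝ)) z + interR (fun i => (y i : ℝ)) z := by
  simp only [interR, Pi.add_apply, Int.cast_add, add_mul, Finset.sum_add_distrib]; ring

/-- The Hodge index inequality for the anticanonical class, as Cauchy–Schwarz. -/
lemma sq_sum_succ_le (x : Fin (n + 1) → ℤ) :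
    (interZ (antiK n) x - 3 * x 0) ^ 2 ≤ n * (x 0 ^ 2 - interZ x x) := by
  have h := sq_sum_le_card_mul_sum_sq (s := Finset.univ) (f := fun i : Fin n => x i.succ)
  rw [interZ_antiK_left, interZ_eq]
  simpa [pow_two] using h

end Bilinear

section Classes

variable {n : ℕ}

lemma isMinusOneClass_single_succ (i : Fin n) :
    IsMinusOneClass (Pi.single i.succ 1 : Fin (n + 1) → ℤ) := by
  simp [IsMinusOneClass, interZ_single_succ, antiK]

/-- The class of the line through two of the blown-up points. -/
def lineClass (i j : Fin n) : Fin (n + 1) → ℤ :=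
  Pi.single 0 1 - Pi.single i.succ 1 - Pi.single j.succ 1

lemma interZ_lineClass (x : Fin (n + 1) → ℤ) (i j : Fin n) :
    interZ x (lineClass i j) = x 0 + x i.succ + x j.succ := by
  simp [lineClass, interZ_sub_right, interZ_single_zero, interZ_single_succ]

lemma isMinusOneClass_lineClass {i j : Fin n} (h : i ≠ j) :
    IsMinusOneClass (lineClass i j) := by
  constructor
  · rw [interZ_lineClass]
    simp [lineClass, h, h.symm]
  · simp [interZ_lineClass, antiK]

lemma IsMinusOneClass.conic_sub {C F : Fin (n + 1) → ℤ} (hF : IsMinusOneClass F)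
    (hC : interZ C C = 0) (hK : interZ (antiK n) C = 2) (hCF : interZ C F = 0) :
    IsMinusOneClass (C - F) := by
  obtain ⟨h1, h2⟩ := hF
  constructor
  · rw [interZ_sub_left, interZ_sub_right, interZ_sub_right, interZ_comm F C]; linarith
  · rw [interZ_sub_right]; linarith

lemma IsMinusOneClass.antiK_sub {F : Fin (7 + 1) → ℤ} (hF : IsMinusOneClass F) :
    IsMinusOneClass (antiK 7 - F) := by
  obtain ⟨h1, h2⟩ := hF
  have h3 := interZ_antiK_self (n := 7)
  constructor
  · rw [interZ_sub_left, interZ_sub_right, interZ_sub_right, interZ_comm F]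
    push_cast at h3; linarith
  · rw [interZ_sub_right]; push_cast at h3; linarith

end Classes

section Conics

lemma Int.mul_sub_one_nonneg (a : ℤ) : 0 ≤ a * (a - 1) := by
  rcases le_or_gt a 0 with h | h <;> nlinarith

/-- A sum exceeding the number of its terms has a term at least `2`. -/
lemma Finset.exists_two_le_of_card_lt_sum {ι : Type*} {t : Finset ι} {c : ι → ℤ}
    (h : (t.card : ℤ) < ∑ i ∈ t, c i) : ∃ i ∈ t, 2 ≤ c i := by
  obtain ⟨i, hi, hlt⟩ := Finset.exists_lt_of_sum_lt (s := t) (f := fun _ => (1 : ℤ)) (g := c)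
    (by simpa using h)
  exact ⟨i, hi, by linarith⟩

/-- The multiplicities of a conic class `(d; c)` on a blow-up in at most seven points meet one of
three numerical conditions, each giving a component of a reducible conic in that class. -/
lemma conic_multiplicities {n : ℕ} (h2 : 2 ≤ n) (h7 : n ≤ 7) (d : ℤ) (c : Fin n → ℤ)
    (hsum : ∑ i, c i = 3 * d - 2) (hsq : ∑ i, c i ^ 2 = d ^ 2) :
    (∃ i, c i = 0) ∨ (∃ i j, i ≠ j ∧ c i + c j = d) ∨
      (n = 7 ∧ ∃ i j, i ≠ j ∧ c i + c j = d - 2) := by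
  have hn : (n : ℤ) ≤ 7 := by exact_mod_cast h7
  have hCS := sq_sum_le_card_mul_sum_sq (s := Finset.univ) (f := c)
  rw [hsum, hsq, Finset.card_univ, Fintype.card_fin] at hCS
  have hCS' : (3 * d - 2) ^ 2 ≤ 7 * d ^ 2 := by nlinarith [sq_nonneg d]
  have hd1 : 1 ≤ d := by by_contra! h; nlinarith
  have hd5 : d ≤ 5 := by by_contra! h; nlinarith
  have hp : ∑ i, c i * (c i - 1) = (d - 1) * (d - 2) := by
    have : ∑ i, c i * (c i - 1) = ∑ i, c i ^ 2 - ∑ i, c i := by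
      rw [← Finset.sum_sub_distrib]; exact Finset.sum_congr rfl fun i _ => by ring
    rw [this, hsum, hsq]; ring
  have hle (i : Fin n) : c i * (c i - 1) ≤ (d - 1) * (d - 2) := hp ▸
    Finset.single_le_sum (f := fun i => c i * (c i - 1))
      (fun i _ => Int.mul_sub_one_nonneg (c i)) (Finset.mem_univ i)
  have hle2 (i j : Fin n) (hij : i ≠ j) :
      c i * (c i - 1) + c j * (c j - 1) ≤ (d - 1) * (d - 2) := by
    rw [← hp, ← Finset.sum_pair (f := fun i => c i * (c i - 1)) hij]
    exact Finset.sum_le_sum_of_subset_of_nonneg (Finset.subset_univ _)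
      (fun i _ _ => Int.mul_sub_one_nonneg (c i))
  have herase (i : Fin n) : ∑ j ∈ Finset.univ.erase i, c j = 3 * d - 2 - c i := by
    rw [← hsum, ← Finset.add_sum_erase _ c (Finset.mem_univ i)]; ring
  have hcard (i : Fin n) : ((Finset.univ.erase i).card : ℤ) = n - 1 := by
    rw [Finset.cast_card_erase_of_mem (Finset.mem_univ i)]; simp
  have hbig (h : (7 : ℤ) < 3 * d - 2) : ∃ i, 2 ≤ c i := by
    obtain ⟨i, -, hi⟩ := Finset.exists_two_le_of_card_lt_sum (t := Finset.univ) (c := c)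
      (by rw [hsum]; simp; omega)
    exact ⟨i, hi⟩
  by_cases h0 : ∃ i, c i = 0
  · exact Or.inl h0
  right
  push Not at h0
  have heq_one (hd : d ≤ 2) (i : Fin n) : c i = 1 := by
    have h1 := hle i
    have h2 : (d - 1) * (d - 2) = 0 := by interval_cases d <;> rfl
    have h3 := Int.mul_sub_one_nonneg (c i)
    have h4 : c i * (c i - 1) = 0 := by linarith
    rcases mul_eq_zero.1 h4 with h | h
    · exact absurd h (h0 i)
    · linarith
  let a : Fin n := ⟨0, by omega⟩
  let b : Fin n := ⟨1, by omega⟩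
  have hab : a ≠ b := by simp [a, b, Fin.ext_iff]
  interval_cases d
  · have := hsum
    simp [heq_one] at this
    omega
  · left
    exact ⟨a, b, hab, by simp [heq_one]⟩
  · left
    obtain ⟨i, hi⟩ : ∃ i, 2 ≤ c i := by
      by_contra! h
      have h1 (i : Fin n) : c i ^ 2 ≤ c i * (c i - 1) + 1 := by nlinarith [h i]
      have h2 := Finset.sum_le_sum (s := Finset.univ) fun i _ => h1 i
      rw [Finset.sum_add_distrib, hp, hsq] at h2
      have h3 := Finset.sum_le_sum (s := Finset.univ) fun i _ =>
        (show c i ≤ 1 by linarith [h i])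
      rw [hsum] at h3
      simp at h2 h3
      have h4 : (n : ℤ) = 7 := by omega
      have h5 : ∑ i, (1 - c i) = 0 := by
        rw [Finset.sum_sub_distrib, hsum]; simp [h4]
      have h6 := (Finset.sum_eq_zero_iff_of_nonneg (fun i _ => by linarith [h i])).1 h5
      have h7 (i : Fin n) : c i = 1 := by linarith [h6 i (Finset.mem_univ i)]
      simp [h7] at hsq
      omega
    have hi2 : c i = 2 := by nlinarith [hle i]
    obtain ⟨j, hj, hlt⟩ := Finset.exists_lt_of_sum_lt (s := Finset.univ.erase i)
      (f := fun _ => (0 : ℤ)) (g := c) (by rw [herase, hi2]; simp)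
    have hji := Finset.ne_of_mem_erase hj
    refine ⟨i, j, hji.symm, ?_⟩
    have := hle2 i j hji.symm
    rw [hi2] at this ⊢
    nlinarith
  · left
    obtain ⟨i, hi⟩ := hbig (by norm_num)
    have hi3 : c i ≤ 3 := by nlinarith [hle i]
    obtain ⟨j, hj, hj2⟩ := Finset.exists_two_le_of_card_lt_sum (t := Finset.univ.erase i) (c := c)
      (by rw [herase, hcard]; omega)
    have hji := (Finset.ne_of_mem_erase hj).symm
    have h := hle2 i j hji
    refine ⟨i, j, hji, ?_⟩
    nlinarith
  · right
    have hterm (i : Fin n) : 0 ≤ (c i - 1) * (c i - 2) := by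
      have := Int.mul_sub_one_nonneg (c i - 1); linarith
    have hq : ∑ i, (c i - 1) * (c i - 2) = 2 * n - 14 := by
      have : ∑ i, (c i - 1) * (c i - 2) = ∑ i, c i ^ 2 - 3 * ∑ i, c i + ∑ i : Fin n, 2 := by
        rw [Finset.mul_sum, ← Finset.sum_sub_distrib, ← Finset.sum_add_distrib]
        exact Finset.sum_congr rfl fun i _ => by ring
      rw [this, hsum, hsq]; simp; ring
    have hq0 := Finset.sum_nonneg (s := Finset.univ) fun i _ => hterm i
    have hn7 : (n : ℤ) = 7 := by omega
    have hval (i : Fin n) : c i = 1 ∨ c i = 2 := by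
      have h := (Finset.sum_eq_zero_iff_of_nonneg fun i _ => hterm i).1 (by rw [hq, hn7]; rfl) i
        (Finset.mem_univ i)
      rcases mul_eq_zero.1 h with h | h
      · left; linarith
      · right; linarith
    refine ⟨by exact_mod_cast hn7, ?_⟩
    obtain ⟨i, hi⟩ := hbig (by norm_num)
    obtain ⟨j, hj⟩ : ∃ j, c j = 1 := by
      by_contra! h
      have h2 (j : Fin n) : c j = 2 := (hval j).resolve_left (h j)
      simp [h2, hn7] at hsum
    exact ⟨i, j, fun h => by rw [h] at hi; omega, by have := hval i; omega⟩

lemma exists_isMinusOneClass_orthogonal_conic {n : ℕ} (h2 : 2 ≤ n) (h7 : n ≤ 7)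
    {C : Fin (n + 1) → ℤ} (hC : interZ C C = 0) (hK : interZ (antiK n) C = 2) :
    ∃ F, IsMinusOneClass F ∧ interZ C F = 0 := by
  have hK' := hK
  rw [interZ_antiK_left] at hK
  have hC' := hC
  rw [interZ_eq] at hC
  rcases conic_multiplicities h2 h7 (C 0) (fun i => -C i.succ)
    (by rw [Finset.sum_neg_distrib]; linarith)
    (by simp only [pow_two, neg_mul_neg]; linarith) with ⟨i, hi⟩ | ⟨i, j, hij, h⟩ | ⟨rfl, i, j, hij, h⟩
  · exact ⟨_, isMinusOneClass_single_succ i, by rw [interZ_single_succ, hi]⟩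
  · exact ⟨_, isMinusOneClass_lineClass hij, by rw [interZ_lineClass]; linarith⟩
  · refine ⟨_, (isMinusOneClass_lineClass hij).antiK_sub, ?_⟩
    rw [interZ_sub_right, interZ_lineClass, interZ_comm, hK']; linarith

end Conics

section Nef

variable {n : ℕ} {y : Fin (n + 1) → ℝ}

lemma NefCone.conic_nonneg (hy : y ∈ NefCone n) (h2 : 2 ≤ n) (h7 : n ≤ 7)
    {C : Fin (n + 1) → ℤ} (hC : interZ C C = 0) (hK : interZ (antiK n) C = 2) :
    0 ≤ interR (fun i => (C i : ℝ)) y := by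
  obtain ⟨F, hF, hCF⟩ := exists_isMinusOneClass_orthogonal_conic h2 h7 hC hK
  rw [← sub_add_cancel C F, interR_cast_add]
  exact add_nonneg (hy _ (hF.conic_sub hC hK hCF)) (hy _ hF)

lemma NefCone.antiK_nonneg (hy : y ∈ NefCone n) (h6 : 6 ≤ n) (h7 : n ≤ 7) :
    0 ≤ interR (fun i => (antiK n i : ℝ)) y := by
  have hF : IsMinusOneClass (Pi.single (Fin.succ ⟨0, by omega⟩) 1 : Fin (n + 1) → ℤ) :=
    isMinusOneClass_single_succ _
  set F : Fin (n + 1) → ℤ := Pi.single (Fin.succ ⟨0, by omega⟩) 1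
  rw [← sub_add_cancel (antiK n) F, interR_cast_add]
  refine add_nonneg ?_ (hy _ hF)
  obtain rfl | rfl : n = 6 ∨ n = 7 := by omega
  · have h := interZ_antiK_self (n := 6)
    push_cast at h
    apply NefCone.conic_nonneg hy (by norm_num) (by norm_num)
    · rw [interZ_sub_left, interZ_sub_right, interZ_sub_right, interZ_comm F, hF.1, hF.2, h]
      norm_num
    · rw [interZ_sub_right, hF.2, h]; norm_num
  · exact hy _ hF.antiK_sub

/-- A class of `H`-degree `3k` equals `-kK` as soon as the sum of the squares of its coordinate
differences with `-kK`, expressed through intersection numbers, is nonpositive. -/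
lemma eq_smul_antiK {x : Fin (n + 1) → ℤ} {k : ℤ} (h0 : x 0 = 3 * k)
    (h : n * k ^ 2 + 9 * k ^ 2 - interZ x x + 2 * k * (interZ (antiK n) x - 9 * k) ≤ 0) :
    x = k • antiK n := by
  have hsum : ∑ i : Fin n, (x i.succ + k) ^ 2 ≤ 0 := by
    have : ∑ i : Fin n, (x i.succ + k) ^ 2 =
        ∑ i : Fin n, x i.succ * x i.succ + 2 * k * ∑ i : Fin n, x i.succ + n * k ^ 2 := by
      have hc : (n : ℤ) * k ^ 2 = ∑ _i : Fin n, k ^ 2 := by simp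
      rw [Finset.mul_sum, hc, ← Finset.sum_add_distrib, ← Finset.sum_add_distrib]
      exact Finset.sum_congr rfl fun i _ => by ring
    rw [interZ_eq, interZ_antiK_left, h0] at h
    linarith
  have hz := (Finset.sum_eq_zero_iff_of_nonneg fun i _ => sq_nonneg (x (Fin.succ i) + k)).1
    (le_antisymm hsum (Finset.sum_nonneg fun i _ => sq_nonneg _))
  funext i
  refine Fin.cases ?_ (fun i => ?_) i
  · simp [antiK, h0, mul_comm]
  · have := pow_eq_zero_iff (two_ne_zero) |>.1 (hz i (Finset.mem_univ i))
    simp [antiK]; linarith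

/-- A nef class is nonnegative on the image of a `(-1)`-class `E` under contraction of a
`(-1)`-curve meeting `E` with multiplicity `m`. -/
lemma NefCone.contraction_nonneg (hy : y ∈ NefCone n) (h2 : 2 ≤ n) (h7 : n ≤ 7)
    {x : Fin (n + 1) → ℤ} {m : ℤ} (hx : interZ x x = m ^ 2 - 1)
    (hK : interZ (antiK n) x = 1 + m) : 0 ≤ interR (fun i => (x i : ℝ)) y := by
  have hn : (n : ℤ) ≤ 7 := by exact_mod_cast h7
  have hCS := sq_sum_succ_le x
  have hpos : 0 ≤ x 0 ^ 2 - interZ x x := by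
    rw [interZ_eq, sub_sub_eq_add_sub, pow_two, add_sub_cancel_left]
    exact Finset.sum_nonneg fun i _ => mul_self_nonneg _
  rw [hx] at hpos
  rw [hK, hx] at hCS
  have hCS7 : (1 + m - 3 * x 0) ^ 2 ≤ 7 * (x 0 ^ 2 - (m ^ 2 - 1)) := by nlinarith
  have hm : 0 ≤ (m + 1) * (3 - m) := by nlinarith [sq_nonneg (2 * x 0 - 3 * (1 + m))]
  have hm1 : -1 ≤ m := by by_contra! h; nlinarith
  have hm3 : m ≤ 3 := by by_contra! h; nlinarith
  have eq_mul {k : ℤ} (h0 : x 0 = 3 * k)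
      (h : n * k ^ 2 + 9 * k ^ 2 - interZ x x + 2 * k * (interZ (antiK n) x - 9 * k) ≤ 0) :
      interR (fun i => (x i : ℝ)) y = k * interR (fun i => (antiK n i : ℝ)) y := by
    rw [eq_smul_antiK h0 h]
    simp only [interR, Pi.smul_apply, smul_eq_mul, Int.cast_mul, mul_assoc, ← Finset.mul_sum]
    ring
  interval_cases m
  · have h0 : x 0 = 0 := by nlinarith
    rw [eq_mul (k := 0) (by simpa using h0) (by simp [hx])]
    simp
  · exact hy _ ⟨by simpa using hx, by simpa using hK⟩
  · exact NefCone.conic_nonneg hy h2 h7 (by simpa using hx) (by simpa using hK)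
  · by_cases hn7 : n = 7
    · subst hn7
      have h := interZ_antiK_self (n := 7)
      push_cast at h
      rw [← sub_add_cancel x (antiK 7), interR_cast_add]
      refine add_nonneg (hy _ ⟨?_, ?_⟩) (NefCone.antiK_nonneg hy (by norm_num) le_rfl)
      · rw [interZ_sub_left, interZ_sub_right, interZ_sub_right, interZ_comm x (antiK 7), hK, hx, h]
        norm_num
      · rw [interZ_sub_right, hK, h]; norm_num
    · have hn6 : (n : ℤ) ≤ 6 := by omega
      have hCS6 : (1 + 2 - 3 * x 0) ^ 2 ≤ 6 * (x 0 ^ 2 - (2 ^ 2 - 1)) := by nlinarith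
      have h0 : x 0 = 3 := by nlinarith [sq_nonneg (x 0 - 3)]
      rw [h0] at hCS
      have h6 : 6 ≤ n := by omega
      rw [eq_mul (k := 1) (by simpa using h0) (by rw [hx, hK]; linarith)]
      simpa using NefCone.antiK_nonneg hy h6 h7
  · have h0 : x 0 = 6 := by nlinarith [sq_nonneg (x 0 - 6)]
    rw [h0] at hCS
    have h6 : 6 ≤ n := by omega
    rw [eq_mul (k := 2) (by simpa using h0) (by rw [hx, hK]; linarith)]
    exact mul_nonneg (by norm_num) (NefCone.antiK_nonneg hy h6 h7)

end Nef

section Embedding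

variable {s : ℕ}

lemma interZ_eq_init (x y : Fin (s + 1 + 1) → ℤ) :
    interZ x y = interZ (Fin.init x : Fin (s + 1) → ℤ) (Fin.init y)
      - x (Fin.last (s + 1)) * y (Fin.last (s + 1)) := by
  rw [interZ, Fin.sum_univ_castSucc, ← sub_sub]; rfl

lemma interR_eq_init (x y : Fin (s + 1 + 1) → ℝ) :
    interR x y = interR (Fin.init x : Fin (s + 1) → ℝ) (Fin.init y)
      - x (Fin.last (s + 1)) * y (Fin.last (s + 1)) := by
  rw [interR, Fin.sum_univ_castSucc, ← sub_sub]; rfl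

lemma init_antiK : (Fin.init (antiK (s + 1)) : Fin (s + 1) → ℤ) = antiK s := by
  funext i
  simp [Fin.init, antiK]

lemma interZ_antiK_eq_init (x : Fin (s + 1 + 1) → ℤ) :
    interZ (antiK (s + 1)) x = interZ (antiK s) (Fin.init x) + x (Fin.last (s + 1)) := by
  rw [interZ_eq_init, init_antiK]
  simp [antiK]

lemma interR_exceptional (x : Fin (s + 1 + 1) → ℝ) :
    interR (fun i => if i = Fin.last (s + 1) then (1 : ℝ) else 0) x
      = -x (Fin.last (s + 1)) := by
  have h : (0 : Fin (s + 1 + 1)) ≠ Fin.last (s + 1) := (Fin.last_pos).ne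
  simp [interR, h]

lemma IsMinusOneClass.snoc {E : Fin (s + 1) → ℤ} (hE : IsMinusOneClass E) :
    IsMinusOneClass (Fin.snoc E 0 : Fin (s + 1 + 1) → ℤ) := by
  constructor
  · rw [interZ_eq_init]; simpa using hE.1
  · rw [interZ_antiK_eq_init]; simpa using hE.2

end Embedding

theorem nef_face_eq_embedded_nef (s : ℕ) (h3 : 3 ≤ s + 1) (h8 : s + 1 ≤ 8) :
    {x ∈ NefCone (s + 1) |
        interR (fun i => if i = Fin.last (s + 1) then (1 : ℝ) else 0) x = 0}
      = (fun y : Fin (s + 1) → ℝ => Fin.snoc y 0) '' NefCone s := by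
  ext x
  simp only [Set.mem_ofPred_eq, Set.mem_image, interR_exceptional, neg_eq_zero]
  constructor
  · rintro ⟨hx, h0⟩
    refine ⟨Fin.init x, fun E hE => ?_, by rw [← h0, Fin.snoc_init_self]⟩
    have h := hx _ hE.snoc
    rw [interR_eq_init, h0, mul_zero, sub_zero] at h
    simpa [Fin.init_def] using h
  · rintro ⟨y, hy, rfl⟩
    refine ⟨fun E hE => ?_, by simp⟩
    obtain ⟨h1, h2⟩ := hE
    rw [interZ_eq_init] at h1
    rw [interZ_antiK_eq_init] at h2
    rw [interR_eq_init, Fin.snoc_last, mul_zero, sub_zero, Fin.init_snoc]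
    exact NefCone.contraction_nonneg hy (by omega) (by omega) (x := Fin.init E)
      (m := -E (Fin.last (s + 1))) (by linarith) (by linarith)
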